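/- For a 32-bit word x, a rotation amount c₁ with c₁ < 32, and a mask constant c₂ < 2^(32 − c₁), the bitwise AND of the right-rotation of x by c₁ bits with c₂ equals the bitwise AND of the logical right shift of x by c₁ bits with c₂; i.e. (rotateRight(x, c₁)) AND c₂ = (x >>> c₁) AND c₂ as 32-bit words. -/

import Mathlib

theorem rotate_and_mask_eq_shift_and_mask
    (x : BitVec 32) (c₁ c₂ : ℕ) (hc₁ : c₁ < 32) (hc₂ : c₂ < 2 ^ (32 - c₁)) :
    (x.rotateRight c₁) &&& (BitVec.ofNat 32 c₂) = (x >>> c₁) &&& (BitVec.ofNat 32 c₂) := by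
  apply BitVec.eq_of_getLsbD_eq
  intro i _
  rw [BitVec.getLsbD_and, BitVec.getLsbD_and, BitVec.getLsbD_ofNat,
    BitVec.getLsbD_rotateRight_of_lt hc₁, BitVec.getLsbD_ushiftRight]
  by_cases h : i < 32 - c₁
  · simp [h]
  · have hbit : c₂.testBit i = false :=
      Nat.testBit_lt_two_pow (hc₂.trans_le (Nat.pow_le_pow_right two_pos (not_lt.mp h)))
    simp [hbit]
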